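/- arXiv:2403.14822 — 2 statements merged into one kernel-verified Lean document; each statement's English description precedes it below -/
import Mathlib

section
/- Let Z be a real-valued random variable on a probability space (with P the underlying probability measure) and let ε ≥ 0. If there exists β ≤ 0 such that E[(Z − β)₊] < ∞ and ε·β + E[(Z − β)₊] ≤ 0, then P{Z > 0} ≤ ε. -/
open MeasureTheory

/-- CVaR conservative approximation of a chance constraint: if there is `β ≤ 0` with
`E[(Z - β)₊] < ∞` and `ε·β + E[(Z - β)₊] ≤ 0`, then `P{Z > 0} ≤ ε`. -/
theorem cvar_implies_chance_constraint
    {Ω : Type*} [MeasurableSpace Ω] (P : Measure Ω) [IsProbabilityMeasure P]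
    (Z : Ω → ℝ) (hZ : Measurable Z) (ε : ℝ) (hε : 0 ≤ ε)
    (h : ∃ β : ℝ, β ≤ 0 ∧ Integrable (fun ω => max (Z ω - β) 0) P ∧
      ε * β + ∫ ω, max (Z ω - β) 0 ∂P ≤ 0) :
    P {ω | 0 < Z ω} ≤ ENNReal.ofReal ε := by
  obtain ⟨β, hβ, hint, hle⟩ := h
  have hnonneg : 0 ≤ᵐ[P] fun ω => max (Z ω - β) 0 :=
    Filter.Eventually.of_forall fun ω => le_max_right _ _
  rcases hβ.lt_or_eq with hβ | rfl
  · have hmarkov := mul_meas_ge_le_integral_of_nonneg hnonneg hint (-β)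
    have hsub : {ω | 0 < Z ω} ⊆ {ω | -β ≤ max (Z ω - β) 0} := by
      intro ω hω
      rw [Set.mem_ofPred_eq] at hω ⊢
      exact le_max_of_le_left (by linarith)
    have hreal : P.real {ω | -β ≤ max (Z ω - β) 0} ≤ ε :=
      le_of_mul_le_mul_left (by linarith) (neg_pos.mpr hβ)
    rw [← ofReal_measureReal]
    exact ENNReal.ofReal_le_ofReal ((measureReal_mono hsub).trans hreal)
  · have hzero : ∫ ω, max (Z ω - 0) 0 ∂P = 0 :=
      le_antisymm (by linarith) (integral_nonneg_of_ae hnonneg)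
    have hae := (integral_eq_zero_iff_of_nonneg_ae hnonneg hint).mp hzero
    have hnull : P {ω | 0 < Z ω} = 0 := by
      refine measure_mono_null (fun ω (hω : 0 < Z ω) => ?_) (ae_iff.mp hae)
      simpa using hω
    simp [hnull]
end

section
/- Let (X, μ) be a probability space and q : X → [0,1] a measurable function with σ² := ∫ q(1 − q) dμ > 0; write σ := √(σ²). For δ > 0 define g(δ) := inf_{λ > 0} { λ + (λ/δ) ∫ [ log( 1 + q(x)·(e^{√δ/λ} − 1) ) − q(x)·√δ/λ ] dμ(x) }. Then lim_{δ → 0⁺} g(δ) = √2 · σ. -/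
open MeasureTheory Filter

/-- A function vanishing at `0` with nonnegative derivative on `[0, ∞)` is nonnegative there. -/
lemma nonneg_of_hasDerivAt_nonneg {f f' : ℝ → ℝ} (h0 : f 0 = 0)
    (hf : ∀ t, 0 ≤ t → HasDerivAt f (f' t) t) (hf' : ∀ t, 0 ≤ t → 0 ≤ f' t)
    {t : ℝ} (ht : 0 ≤ t) : 0 ≤ f t := by
  have hmono : MonotoneOn f (Set.Ici 0) := by
    refine monotoneOn_of_deriv_nonneg (convex_Ici 0)
      (fun x hx => (hf x hx).continuousAt.continuousWithinAt)
      (fun x hx => (hf x (interior_subset hx)).differentiableAt.differentiableWithinAt)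
      (fun x hx => ?_)
    rw [(hf x (interior_subset hx)).deriv]
    exact hf' x (interior_subset hx)
  exact h0 ▸ hmono Set.self_mem_Ici ht ht

lemma one_le_one_add_mul_exp_sub_one {p t : ℝ} (hp : p ∈ Set.Icc (0 : ℝ) 1) (ht : 0 ≤ t) :
    1 ≤ 1 + p * (Real.exp t - 1) := by
  have := mul_nonneg hp.1 (sub_nonneg.2 (Real.one_le_exp ht))
  linarith

lemma hasDerivAt_bernoulli_cgf {p t : ℝ} (hp : p ∈ Set.Icc (0 : ℝ) 1) (ht : 0 ≤ t) :
    HasDerivAt (fun t => Real.log (1 + p * (Real.exp t - 1)) - p * t)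
      (p * (1 - p) * ((Real.exp t - 1) / (1 + p * (Real.exp t - 1)))) t := by
  have hD := one_le_one_add_mul_exp_sub_one hp ht
  have hD0 : 1 + p * (Real.exp t - 1) ≠ 0 := by positivity
  have h := (((((Real.hasDerivAt_exp t).sub_const 1).const_mul p).const_add 1).log hD0).sub
    ((hasDerivAt_id t).const_mul p)
  refine h.congr_deriv ?_
  field_simp
  ring

/-- Lower bound on the cumulant generating function of a centred Bernoulli variable. -/
lemma le_bernoulli_cgf {p t : ℝ} (hp : p ∈ Set.Icc (0 : ℝ) 1) (ht : 0 ≤ t) :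
    p * (1 - p) * (t ^ 2 / (2 * (1 + t))) ≤
      Real.log (1 + p * (Real.exp t - 1)) - p * t := by
  have key := nonneg_of_hasDerivAt_nonneg
    (f := fun t => (Real.log (1 + p * (Real.exp t - 1)) - p * t) -
      p * (1 - p) * (t ^ 2 / (2 * (1 + t))))
    (f' := fun t => p * (1 - p) * ((Real.exp t - 1) / (1 + p * (Real.exp t - 1))) -
      p * (1 - p) * ((2 * t + t ^ 2) / (2 * (1 + t) ^ 2)))
    (by simp) (fun t ht => ?_) (fun t ht => ?_) ht
  · exact sub_nonneg.1 key
  · refine (hasDerivAt_bernoulli_cgf hp ht).sub (HasDerivAt.const_mul _ ?_)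
    have h := (hasDerivAt_pow 2 t).div (((hasDerivAt_id t).const_add 1).const_mul 2)
      (by simp only [id]; positivity)
    refine h.congr_deriv ?_
    simp only [id]
    field_simp
    ring
  · have hD := one_le_one_add_mul_exp_sub_one hp ht
    have hE := Real.add_one_le_exp t
    rw [← mul_sub]
    refine mul_nonneg (mul_nonneg hp.1 (sub_nonneg.2 hp.2)) (sub_nonneg.2 ?_)
    have hDE : 1 + p * (Real.exp t - 1) ≤ Real.exp t := by
      nlinarith [hp.2, Real.one_le_exp ht]
    calc (2 * t + t ^ 2) / (2 * (1 + t) ^ 2) ≤ t / (1 + t) := by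
          rw [div_le_div_iff₀ (by positivity) (by positivity)]
          have : 0 ≤ t ^ 2 * (1 + t) := by positivity
          nlinarith
      _ ≤ (Real.exp t - 1) / Real.exp t := by
          rw [div_le_div_iff₀ (by positivity) (by positivity)]
          nlinarith
      _ ≤ _ := div_le_div_of_nonneg_left (by linarith) (by linarith) hDE

/-- Upper bound on the cumulant generating function of a centred Bernoulli variable. -/
lemma bernoulli_cgf_le {p t : ℝ} (hp : p ∈ Set.Icc (0 : ℝ) 1) (ht : 0 ≤ t) :
    Real.log (1 + p * (Real.exp t - 1)) - p * t ≤
      p * (1 - p) * (t ^ 2 / 2 * Real.exp t) := by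
  have key := nonneg_of_hasDerivAt_nonneg
    (f := fun t => p * (1 - p) * (t ^ 2 / 2 * Real.exp t) -
      (Real.log (1 + p * (Real.exp t - 1)) - p * t))
    (f' := fun t => p * (1 - p) * ((t + t ^ 2 / 2) * Real.exp t) -
      p * (1 - p) * ((Real.exp t - 1) / (1 + p * (Real.exp t - 1))))
    (by simp) (fun t ht => ?_) (fun t ht => ?_) ht
  · exact sub_nonneg.1 key
  · refine HasDerivAt.sub (HasDerivAt.const_mul _ ?_) (hasDerivAt_bernoulli_cgf hp ht)
    have h := ((hasDerivAt_pow 2 t).div_const 2).mul (Real.hasDerivAt_exp t)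
    refine h.congr_deriv ?_
    push_cast
    ring
  · have hD := one_le_one_add_mul_exp_sub_one hp ht
    rw [← mul_sub]
    refine mul_nonneg (mul_nonneg hp.1 (sub_nonneg.2 hp.2)) (sub_nonneg.2 ?_)
    have hE := Real.one_le_exp ht
    have hexp : Real.exp t - 1 ≤ t * Real.exp t := by
      have h1 := Real.add_one_le_exp (-t)
      have h2 : Real.exp (-t) * Real.exp t = 1 := by rw [← Real.exp_add]; simp
      nlinarith [Real.exp_pos t]
    calc (Real.exp t - 1) / (1 + p * (Real.exp t - 1)) ≤ Real.exp t - 1 :=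
          div_le_self (by linarith) hD
      _ ≤ (t + t ^ 2 / 2) * Real.exp t := by
          have : 0 ≤ t ^ 2 / 2 * Real.exp t := by positivity
          linarith

section

variable {X : Type*} [MeasurableSpace X] {μ : Measure X} [IsProbabilityMeasure μ] {q : X → ℝ}

lemma integrable_mul_one_sub (hq : Measurable q) (hq01 : ∀ x, q x ∈ Set.Icc (0 : ℝ) 1) :
    Integrable (fun x => q x * (1 - q x)) μ := by
  refine (integrable_const (1 : ℝ)).mono' (by fun_prop) (.of_forall fun x => ?_)
  obtain ⟨h0, h1⟩ := hq01 x
  rw [Real.norm_of_nonneg (mul_nonneg h0 (sub_nonneg.2 h1))]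
  nlinarith

lemma integrable_bernoulli_cgf (hq : Measurable q) (hq01 : ∀ x, q x ∈ Set.Icc (0 : ℝ) 1)
    {t : ℝ} (ht : 0 ≤ t) :
    Integrable (fun x => Real.log (1 + q x * (Real.exp t - 1)) - q x * t) μ := by
  refine ((integrable_mul_one_sub hq hq01).mul_const (t ^ 2 / 2 * Real.exp t)).mono'
    (by fun_prop) (.of_forall fun x => ?_)
  rw [Real.norm_of_nonneg]
  · exact bernoulli_cgf_le (hq01 x) ht
  · refine le_trans ?_ (le_bernoulli_cgf (hq01 x) ht)
    have := mul_nonneg (hq01 x).1 (sub_nonneg.2 (hq01 x).2)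
    positivity

lemma le_integral_bernoulli_cgf (hq : Measurable q) (hq01 : ∀ x, q x ∈ Set.Icc (0 : ℝ) 1)
    {t : ℝ} (ht : 0 ≤ t) :
    (∫ x, q x * (1 - q x) ∂μ) * (t ^ 2 / (2 * (1 + t))) ≤
      ∫ x, (Real.log (1 + q x * (Real.exp t - 1)) - q x * t) ∂μ := by
  rw [← integral_mul_const]
  exact integral_mono ((integrable_mul_one_sub hq hq01).mul_const _)
    (integrable_bernoulli_cgf hq hq01 ht) fun x => le_bernoulli_cgf (hq01 x) ht

lemma integral_bernoulli_cgf_le (hq : Measurable q) (hq01 : ∀ x, q x ∈ Set.Icc (0 : ℝ) 1)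
    {t : ℝ} (ht : 0 ≤ t) :
    ∫ x, (Real.log (1 + q x * (Real.exp t - 1)) - q x * t) ∂μ ≤
      (∫ x, q x * (1 - q x) ∂μ) * (t ^ 2 / 2 * Real.exp t) := by
  rw [← integral_mul_const]
  exact integral_mono (integrable_bernoulli_cgf hq hq01 ht)
    ((integrable_mul_one_sub hq hq01).mul_const _) fun x => bernoulli_cgf_le (hq01 x) ht

end

/-- Variance-regularization effect of Sinkhorn robust testing in the regime `ρ̄/ε → 0`: with
`q : X → [0,1]`, `σ² = ∫ q(1−q) dμ > 0` and
`g(δ) = inf_{λ>0} { λ + (λ/δ) ∫ [log(1 + q(x)(e^{√δ/λ} − 1)) − q(x)√δ/λ] dμ(x) }`,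
one has `g(δ) → √2·σ` as `δ → 0⁺`. -/
theorem sinkhorn_variance_regularization_limit
    {X : Type*} [MeasurableSpace X] (μ : Measure X) [IsProbabilityMeasure μ]
    (q : X → ℝ) (hq : Measurable q) (hq01 : ∀ x, q x ∈ Set.Icc (0 : ℝ) 1)
    (hvar : 0 < ∫ x, q x * (1 - q x) ∂μ)
    (σ : ℝ) (hσ : σ = Real.sqrt (∫ x, q x * (1 - q x) ∂μ))
    (g : ℝ → ℝ)
    (hg : ∀ δ : ℝ, 0 < δ →
      g δ = sInf {v : ℝ | ∃ lam : ℝ, 0 < lam ∧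
        v = lam + (lam / δ) *
          ∫ x, (Real.log (1 + q x * (Real.exp (Real.sqrt δ / lam) - 1)) -
            q x * Real.sqrt δ / lam) ∂μ}) :
    Tendsto g (nhdsWithin 0 (Set.Ioi 0)) (nhds (Real.sqrt 2 * σ)) := by
  have hσ0 : 0 < σ := hσ ▸ Real.sqrt_pos.2 hvar
  have hσ2 : ∫ x, q x * (1 - q x) ∂μ = σ ^ 2 := by rw [hσ, Real.sq_sqrt hvar.le]
  have h2 : (Real.sqrt 2) ^ 2 = 2 := Real.sq_sqrt (by norm_num)
  have h20 : 0 < Real.sqrt 2 := by positivity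
  have hlow : ∀ δ : ℝ, 0 < δ → ∀ lam : ℝ, 0 < lam →
      Real.sqrt 2 * σ - Real.sqrt δ ≤ lam + (lam / δ) *
        ∫ x, (Real.log (1 + q x * (Real.exp (Real.sqrt δ / lam) - 1)) -
          q x * Real.sqrt δ / lam) ∂μ := by
    intro δ hδ lam hlam
    have hs : 0 < Real.sqrt δ := Real.sqrt_pos.2 hδ
    have hsq : δ = (Real.sqrt δ) ^ 2 := (Real.sq_sqrt hδ.le).symm
    simp only [mul_div_assoc]
    have hI := le_integral_bernoulli_cgf (μ := μ) hq hq01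
      (t := Real.sqrt δ / lam) (by positivity)
    rw [hσ2] at hI
    have hm := mul_le_mul_of_nonneg_left hI (a := lam / δ) (by positivity)
    generalize Real.sqrt δ = s at *
    have hAM : lam / δ * (σ ^ 2 * ((s / lam) ^ 2 / (2 * (1 + s / lam)))) =
        σ ^ 2 / (2 * (lam + s)) := by
      rw [hsq]; field_simp
    have hsquare : Real.sqrt 2 * σ ≤ (lam + s) + σ ^ 2 / (2 * (lam + s)) := by
      have hy : 0 < lam + s := by positivity
      generalize lam + s = y at *
      have : y + σ ^ 2 / (2 * y) - Real.sqrt 2 * σ = (Real.sqrt 2 * y - σ) ^ 2 / (2 * y) := by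
        field_simp
        linear_combination (-y ^ 2) * h2
      have : 0 ≤ (Real.sqrt 2 * y - σ) ^ 2 / (2 * y) := by positivity
      linarith
    linarith
  have hupp : ∀ δ : ℝ, 0 < δ →
      (σ / Real.sqrt 2) + ((σ / Real.sqrt 2) / δ) *
        ∫ x, (Real.log (1 + q x * (Real.exp (Real.sqrt δ / (σ / Real.sqrt 2)) - 1)) -
          q x * Real.sqrt δ / (σ / Real.sqrt 2)) ∂μ ≤
      σ / Real.sqrt 2 * (1 + Real.exp (Real.sqrt δ / (σ / Real.sqrt 2))) := by
    intro δ hδ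
    have hsq : δ = (Real.sqrt δ) ^ 2 := (Real.sq_sqrt hδ.le).symm
    have hs : 0 < Real.sqrt δ := Real.sqrt_pos.2 hδ
    simp only [mul_div_assoc]
    have hI := integral_bernoulli_cgf_le (μ := μ) hq hq01
      (t := Real.sqrt δ / (σ / Real.sqrt 2)) (by positivity)
    rw [hσ2] at hI
    have hm := mul_le_mul_of_nonneg_left hI (a := (σ / Real.sqrt 2) / δ) (by positivity)
    have hl : σ ^ 2 = 2 * (σ / Real.sqrt 2) ^ 2 := by rw [div_pow, h2]; ring
    have hl0 : 0 < σ / Real.sqrt 2 := by positivity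
    rw [hl] at hm
    generalize σ / Real.sqrt 2 = l at *
    generalize Real.sqrt δ = s at *
    have : l / δ * (2 * l ^ 2 * ((s / l) ^ 2 / 2 * Real.exp (s / l))) = l * Real.exp (s / l) := by
      rw [hsq]; field_simp
    linarith
  have hg_low : ∀ δ : ℝ, 0 < δ → Real.sqrt 2 * σ - Real.sqrt δ ≤ g δ := by
    intro δ hδ
    rw [hg δ hδ]
    refine le_csInf ⟨_, 1, one_pos, rfl⟩ ?_
    rintro v ⟨lam, hlam, rfl⟩
    exact hlow δ hδ lam hlam
  have hg_upp : ∀ δ : ℝ, 0 < δ →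
      g δ ≤ σ / Real.sqrt 2 * (1 + Real.exp (Real.sqrt δ / (σ / Real.sqrt 2))) := by
    intro δ hδ
    rw [hg δ hδ]
    refine le_trans (csInf_le ⟨Real.sqrt 2 * σ - Real.sqrt δ, ?_⟩
      ⟨σ / Real.sqrt 2, by positivity, rfl⟩) (hupp δ hδ)
    rintro v ⟨lam, hlam, rfl⟩
    exact hlow δ hδ lam hlam
  refine tendsto_of_tendsto_of_tendsto_of_le_of_le' (f := g)
    (g := fun δ => Real.sqrt 2 * σ - Real.sqrt δ)
    (h := fun δ => σ / Real.sqrt 2 * (1 + Real.exp (Real.sqrt δ / (σ / Real.sqrt 2))))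
    ?_ ?_ (eventually_mem_nhdsWithin.mono fun δ hδ => hg_low δ hδ)
    (eventually_mem_nhdsWithin.mono fun δ hδ => hg_upp δ hδ)
  · refine tendsto_nhdsWithin_of_tendsto_nhds ?_
    have hc : Continuous fun δ => Real.sqrt 2 * σ - Real.sqrt δ := by fun_prop
    simpa using hc.tendsto 0
  · refine tendsto_nhdsWithin_of_tendsto_nhds ?_
    have hc : Continuous fun δ =>
        σ / Real.sqrt 2 * (1 + Real.exp (Real.sqrt δ / (σ / Real.sqrt 2))) := by fun_prop
    have hval : σ / Real.sqrt 2 * (1 + 1) = Real.sqrt 2 * σ := by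
      field_simp
      linear_combination -h2
    simpa [hval] using hc.tendsto 0
end
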